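/- arXiv:1603.06357 — 2 statements merged into one kernel-verified Lean document; each statement's English description precedes it below -/
import Mathlib

section
/- For every complex number q with |q| < 1, the infinite product ∏_{n≥1} (1−q^n)²/(1−q^n+q^{2n}) equals 1 + ∑_{n≥1} a₆(n) q^n, where a₆(n) = ∑_{d | n, d odd, d > 0} ξ(2n/d − d). -/
/-- `ξ m` for odd `m`, determined by the residue of `m` modulo 12. -/
def xi (m : ℤ) : ℤ :=
  if m % 12 = 1 ∨ m % 12 = 5 then -1
  else if m % 12 = 3 then -2
  else if m % 12 = 7 ∨ m % 12 = 11 then 1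
  else if m % 12 = 9 then 2
  else 0

/-- `a₆ n = ∑ ξ(2n/d − d)` over odd positive divisors `d` of `n`. -/
def a6 (n : ℕ) : ℤ :=
  ∑ d ∈ n.divisors.filter (fun d => Odd d), xi (2 * ((n : ℤ) / (d : ℤ)) - (d : ℤ))

open Filter Topology Finset

/-- The finite `q`-Pochhammer symbol `(q; q)_n`. -/
noncomputable def qFactorial (q : ℂ) (n : ℕ) : ℂ :=
  ∏ i ∈ range n, (1 - q ^ (i + 1))

/-- The ratio of Gaussian binomials `[2n, n + k] / [2n, n]`, equal to zero for `k > n`. -/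
noncomputable def qCentralRatio (q : ℂ) (n k : ℕ) : ℂ :=
  if k ≤ n then qFactorial q n ^ 2 / (qFactorial q (n - k) * qFactorial q (n + k)) else 0

section

variable {q : ℂ}

lemma one_sub_pow_ne_zero (hq : ‖q‖ < 1) (n : ℕ) : 1 - q ^ (n + 1) ≠ 0 := by
  intro h
  have h1 : ‖q ^ (n + 1)‖ < 1 := by
    rw [norm_pow]
    exact pow_lt_one₀ (norm_nonneg _) hq (by simp)
  rw [← sub_eq_zero.mp h] at h1
  simp at h1

lemma norm_inv_one_sub_add_sq_le (hq : ‖q‖ < 1) (n : ℕ) :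
    ‖(1 - q ^ (n + 1) + q ^ (2 * (n + 1)))⁻¹‖ ≤ 2 / (1 - ‖q‖) := by
  set y := q ^ (n + 1) with hy
  have hy2 : q ^ (2 * (n + 1)) = y ^ 2 := by rw [hy]; ring
  rw [hy2]
  have hyq : ‖y‖ ≤ ‖q‖ := by
    rw [hy, norm_pow]
    exact pow_le_of_le_one (norm_nonneg _) hq.le (by simp)
  have h1 : ‖1 + y‖ ≤ 2 := by
    calc ‖1 + y‖ ≤ ‖(1 : ℂ)‖ + ‖y‖ := norm_add_le _ _
      _ ≤ 2 := by rw [norm_one]; linarith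
  have h3 : 1 - ‖q‖ ≤ ‖1 + y ^ 3‖ := by
    have h4 : ‖(1 : ℂ)‖ - ‖-y ^ 3‖ ≤ ‖(1 : ℂ) - -y ^ 3‖ := norm_sub_norm_le _ _
    have h5 : ‖y‖ ^ 3 ≤ ‖y‖ := pow_le_of_le_one (norm_nonneg _) (by linarith) (by simp)
    rw [norm_one, norm_neg, norm_pow, sub_neg_eq_add] at h4
    linarith
  have h6 : ‖1 + y ^ 3‖ = ‖1 + y‖ * ‖1 - y + y ^ 2‖ := by
    rw [← norm_mul]; congr 1; ring
  have h7 : (1 - ‖q‖) / 2 ≤ ‖1 - y + y ^ 2‖ := by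
    nlinarith [norm_nonneg (1 - y + y ^ 2)]
  have h8 : 0 < (1 - ‖q‖) / 2 := by linarith
  rw [norm_inv, ← inv_div]
  exact inv_anti₀ h8 h7

lemma one_sub_add_sq_ne_zero (hq : ‖q‖ < 1) (n : ℕ) :
    1 - q ^ (n + 1) + q ^ (2 * (n + 1)) ≠ 0 := by
  intro h
  have h3 : (1 + q ^ (n + 1)) * (1 - q ^ (n + 1) + q ^ (2 * (n + 1))) = 1 + q ^ (3 * (n + 1)) := by
    ring
  rw [h, mul_zero] at h3
  have h1 : ‖q ^ (3 * (n + 1))‖ < 1 := by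
    rw [norm_pow]
    exact pow_lt_one₀ (norm_nonneg _) hq (by simp)
  rw [show q ^ (3 * (n + 1)) = -1 by linear_combination -h3] at h1
  simp at h1

lemma qFactorial_succ (q : ℂ) (n : ℕ) :
    qFactorial q (n + 1) = qFactorial q n * (1 - q ^ (n + 1)) := by
  simp [qFactorial, prod_range_succ]

lemma qFactorial_ne_zero (hq : ‖q‖ < 1) (n : ℕ) : qFactorial q n ≠ 0 :=
  prod_ne_zero_iff.mpr fun i _ => one_sub_pow_ne_zero hq i

lemma qCentralRatio_zero (hq : ‖q‖ < 1) (n : ℕ) : qCentralRatio q n 0 = 1 := by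
  have := qFactorial_ne_zero hq n
  simp only [qCentralRatio, Nat.zero_le, if_true, Nat.sub_zero, Nat.add_zero]
  field_simp

lemma qCentralRatio_succ_right (hq : ‖q‖ < 1) {n k : ℕ} (h : k + 1 ≤ n) :
    qCentralRatio q n (k + 1) * (1 - q ^ (n + k + 1)) =
      qCentralRatio q n k * (1 - q ^ (n - k)) := by
  obtain ⟨m, rfl⟩ := Nat.exists_eq_add_of_le h
  have e1 : k + 1 + m - (k + 1) = m := by omega
  have e2 : k + 1 + m - k = m + 1 := by omega
  have e3 : k + 1 + m + (k + 1) = (k + 1 + m + k) + 1 := by omega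
  rw [qCentralRatio, qCentralRatio, if_pos h, if_pos (by omega), e1, e2, e3,
    qFactorial_succ q m, qFactorial_succ q (k + 1 + m + k)]
  have h1 := qFactorial_ne_zero hq m
  have h2 := qFactorial_ne_zero hq (k + 1 + m + k)
  have h3 := one_sub_pow_ne_zero hq m
  have h4 := one_sub_pow_ne_zero hq (k + 1 + m + k)
  generalize qFactorial q (k + 1 + m) = z
  generalize qFactorial q (k + 1 + m + k) = a at *
  generalize 1 - q ^ (k + 1 + m + k + 1) = b at *
  generalize 1 - q ^ (m + 1) = c at *
  field_simp

lemma qCentralRatio_succ_left (hq : ‖q‖ < 1) {n k : ℕ} (h : k ≤ n + 1) :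
    qCentralRatio q n k * (1 - q ^ (n + 1)) ^ 2 =
      qCentralRatio q (n + 1) k * ((1 - q ^ (n + 1 - k)) * (1 - q ^ (n + 1 + k))) := by
  rcases h.eq_or_lt with rfl | h
  · simp [qCentralRatio]
  obtain ⟨m, rfl⟩ := Nat.exists_eq_add_of_le (Nat.lt_succ_iff.mp h)
  have e1 : k + m - k = m := by omega
  have e2 : k + m + 1 - k = m + 1 := by omega
  have e3 : k + m + 1 + k = (k + m + k) + 1 := by omega
  rw [qCentralRatio, qCentralRatio, if_pos h.le, if_pos (by omega), e1, e2, e3,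
    qFactorial_succ q m, qFactorial_succ q (k + m + k), qFactorial_succ q (k + m)]
  have h1 := qFactorial_ne_zero hq m
  have h2 := qFactorial_ne_zero hq (k + m + k)
  have h3 := one_sub_pow_ne_zero hq m
  have h4 := one_sub_pow_ne_zero hq (k + m + k)
  generalize qFactorial q (k + m) = z
  generalize qFactorial q (k + m + k) = a at *
  generalize 1 - q ^ (k + m + k + 1) = b at *
  generalize 1 - q ^ (m + 1) = c at *
  generalize 1 - q ^ (k + m + 1) = d at *
  field_simp

lemma choose_two_succ (n : ℕ) : (n + 1).choose 2 = n.choose 2 + n := by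
  rw [Nat.choose_succ_succ' n 1, Nat.choose_one_right, add_comm]

/-- A telescoping partial sum of central Gaussian binomials with alternating signs. -/
lemma one_add_sum_qCentralRatio (hq : ‖q‖ < 1) (n : ℕ) {j : ℕ} (hj : j ≤ n + 1) :
    1 + ∑ k ∈ range j, (-1) ^ (k + 1) * q ^ (k + 1).choose 2 * (1 + q ^ (k + 1)) *
        qCentralRatio q (n + 1) (k + 1) =
      (-1) ^ j * q ^ (j + 1).choose 2 * (qCentralRatio q (n + 1) j * (1 - q ^ (n + 1 - j))) /
        (1 - q ^ (n + 1)) := by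
  have h0 := one_sub_pow_ne_zero hq n
  induction j with
  | zero => simp [qCentralRatio_zero hq, h0]
  | succ j ih =>
    rw [sum_range_succ, ← add_assoc, ih (by omega), ← qCentralRatio_succ_right hq hj,
      choose_two_succ (j + 1), pow_add q _ (j + 1)]
    obtain ⟨m, hm⟩ := Nat.exists_eq_add_of_le hj
    have e : n + 1 - (j + 1) = m := by omega
    rw [e, eq_div_iff h0, add_mul, div_mul_cancel₀ _ h0, hm]
    ring

/-- Finite form of the partial fraction expansion of the crank generating function at a
primitive sixth root of unity. -/
lemma prod_eq_one_add_sum_qCentralRatio (hq : ‖q‖ < 1) (n : ℕ) :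
    ∏ i ∈ range n, (1 - q ^ (i + 1)) ^ 2 / (1 - q ^ (i + 1) + q ^ (2 * (i + 1))) =
      1 + ∑ j ∈ range n, (-1) ^ (j + 1) * q ^ (j + 2).choose 2 * (1 + q ^ (j + 1)) *
        (1 - q ^ (j + 1) + q ^ (2 * (j + 1)))⁻¹ * qCentralRatio q n (j + 1) := by
  induction n with
  | zero => simp
  | succ n ih =>
    have hD := one_sub_add_sq_ne_zero hq n
    have key := one_add_sum_qCentralRatio hq n le_rfl
    rw [Nat.sub_self, pow_zero, sub_self, mul_zero, mul_zero, zero_div] at key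
    rw [prod_range_succ, ih, ← mul_div_assoc, div_eq_iff hD]
    have hext : ∑ j ∈ range n, (-1) ^ (j + 1) * q ^ (j + 2).choose 2 * (1 + q ^ (j + 1)) *
          (1 - q ^ (j + 1) + q ^ (2 * (j + 1)))⁻¹ * qCentralRatio q n (j + 1) =
        ∑ j ∈ range (n + 1), (-1) ^ (j + 1) * q ^ (j + 2).choose 2 * (1 + q ^ (j + 1)) *
          (1 - q ^ (j + 1) + q ^ (2 * (j + 1)))⁻¹ * qCentralRatio q n (j + 1) := by
      simp [sum_range_succ, qCentralRatio]
    have hterm : ∀ j ∈ range (n + 1),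
        (-1) ^ (j + 1) * q ^ (j + 2).choose 2 * (1 + q ^ (j + 1)) *
          (1 - q ^ (j + 1) + q ^ (2 * (j + 1)))⁻¹ * qCentralRatio q (n + 1) (j + 1) *
          (1 - q ^ (n + 1) + q ^ (2 * (n + 1))) =
        (-1) ^ (j + 1) * q ^ (j + 2).choose 2 * (1 + q ^ (j + 1)) *
          (1 - q ^ (j + 1) + q ^ (2 * (j + 1)))⁻¹ * qCentralRatio q n (j + 1) *
          (1 - q ^ (n + 1)) ^ 2 +
        (-1) ^ (j + 1) * q ^ (j + 1).choose 2 * (1 + q ^ (j + 1)) *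
          qCentralRatio q (n + 1) (j + 1) * q ^ (n + 1) := by
      intro j hj
      have hj' : j + 1 ≤ n + 1 := by simpa using hj
      rw [mul_assoc _ (qCentralRatio q n (j + 1)), qCentralRatio_succ_left hq hj']
      obtain ⟨m, hm⟩ := Nat.exists_eq_add_of_le hj'
      have e : n + 1 - (j + 1) = m := by omega
      have hDj := one_sub_add_sq_ne_zero hq j
      rw [e, hm, choose_two_succ (j + 1), pow_add q _ (j + 1)]
      field_simp
      ring
    rw [hext, add_mul, add_mul, sum_mul, sum_mul, sum_congr rfl hterm, sum_add_distrib,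
      ← sum_mul _ _ (q ^ (n + 1))]
    linear_combination (-q ^ (n + 1)) * key

lemma summable_norm_pow_succ (hq : ‖q‖ < 1) : Summable fun n : ℕ => ‖q ^ (n + 1)‖ := by
  simp only [norm_pow]
  exact (summable_nat_add_iff 1).mpr (summable_geometric_of_lt_one (norm_nonneg _) hq)

lemma exists_tendsto_qFactorial (hq : ‖q‖ < 1) :
    ∃ L : ℂ, L ≠ 0 ∧ Tendsto (qFactorial q) atTop (𝓝 L) := by
  have hs : Summable fun n : ℕ => ‖-q ^ (n + 1)‖ := by
    simpa only [norm_neg] using summable_norm_pow_succ hq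
  refine ⟨∏' n : ℕ, (1 + -q ^ (n + 1)), ?_, ?_⟩
  · exact tprod_one_add_ne_zero_of_summable
      (fun n => by simpa [← sub_eq_add_neg] using one_sub_pow_ne_zero hq n) hs
  · simp only [funext (qFactorial.eq_1 q), sub_eq_add_neg]
    exact (multipliable_one_add_of_summable hs).hasProd.tendsto_prod_nat

lemma tendsto_qCentralRatio (hq : ‖q‖ < 1) (k : ℕ) :
    Tendsto (fun n => qCentralRatio q n k) atTop (𝓝 1) := by
  obtain ⟨L, hL, ht⟩ := exists_tendsto_qFactorial hq
  have h := (ht.pow 2).div ((ht.comp (tendsto_sub_atTop_nat k)).mul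
    (ht.comp (tendsto_add_atTop_nat k))) (mul_ne_zero hL hL)
  rw [← sq, div_self (pow_ne_zero 2 hL)] at h
  refine h.congr' ?_
  filter_upwards [eventually_ge_atTop k] with n hn
  simp [qCentralRatio, hn]

lemma exists_norm_qCentralRatio_le (hq : ‖q‖ < 1) :
    ∃ C : ℝ, ∀ n k, ‖qCentralRatio q n k‖ ≤ C := by
  obtain ⟨L, hL, ht⟩ := exists_tendsto_qFactorial hq
  obtain ⟨A, hA⟩ := ht.norm.bddAbove_range
  obtain ⟨B, hB⟩ := (ht.inv₀ hL).norm.bddAbove_range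
  have hA' : ∀ n, ‖qFactorial q n‖ ≤ A := fun n => hA ⟨n, rfl⟩
  have hB' : ∀ n, ‖(qFactorial q n)⁻¹‖ ≤ B := fun n => hB ⟨n, rfl⟩
  have hB0 : 0 ≤ B := (norm_nonneg _).trans (hB' 0)
  refine ⟨A ^ 2 * (B * B), fun n k => ?_⟩
  rw [qCentralRatio]
  split_ifs
  · rw [div_eq_mul_inv, mul_inv, norm_mul, norm_mul, norm_pow]
    gcongr
    exacts [hA' n, hB' _, hB' _]
  · rw [norm_zero]
    positivity

lemma norm_crank_term_le (hq : ‖q‖ < 1) (j : ℕ) :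
    ‖(-1) ^ (j + 1) * q ^ (j + 2).choose 2 * (1 + q ^ (j + 1)) *
      (1 - q ^ (j + 1) + q ^ (2 * (j + 1)))⁻¹‖ ≤ ‖q‖ ^ j * 2 * (2 / (1 - ‖q‖)) := by
  rw [norm_mul, norm_mul, norm_mul, norm_pow, norm_neg, norm_one, one_pow, one_mul]
  have h1 : ‖q ^ (j + 2).choose 2‖ ≤ ‖q‖ ^ j := by
    rw [norm_pow]
    refine pow_le_pow_of_le_one (norm_nonneg _) hq.le ?_
    rw [choose_two_succ]
    omega
  have h2 : ‖1 + q ^ (j + 1)‖ ≤ 2 := by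
    refine (norm_add_le _ _).trans ?_
    rw [norm_one, norm_pow]
    linarith [pow_le_one₀ (n := j + 1) (norm_nonneg q) hq.le]
  have h3 := norm_inv_one_sub_add_sq_le hq j
  gcongr

lemma tprod_eq_one_add_tsum_crank (hq : ‖q‖ < 1) :
    ∏' n : ℕ, (1 - q ^ (n + 1)) ^ 2 / (1 - q ^ (n + 1) + q ^ (2 * (n + 1))) =
      1 + ∑' j : ℕ, (-1) ^ (j + 1) * q ^ (j + 2).choose 2 * (1 + q ^ (j + 1)) *
        (1 - q ^ (j + 1) + q ^ (2 * (j + 1)))⁻¹ := by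
  have hfac : ∀ n : ℕ, (1 - q ^ (n + 1)) ^ 2 / (1 - q ^ (n + 1) + q ^ (2 * (n + 1))) =
      1 + -q ^ (n + 1) * (1 - q ^ (n + 1) + q ^ (2 * (n + 1)))⁻¹ := by
    intro n
    have hD := one_sub_add_sq_ne_zero hq n
    field_simp
    ring
  have hmul : Multipliable fun n : ℕ =>
      (1 - q ^ (n + 1)) ^ 2 / (1 - q ^ (n + 1) + q ^ (2 * (n + 1))) := by
    simp only [hfac]
    refine multipliable_one_add_of_summable ?_
    refine Summable.of_nonneg_of_le (fun _ => norm_nonneg _) (fun n => ?_)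
      ((summable_norm_pow_succ hq).mul_right (2 / (1 - ‖q‖)))
    rw [norm_mul, norm_neg]
    exact mul_le_mul_of_nonneg_left (norm_inv_one_sub_add_sq_le hq n) (norm_nonneg _)
  refine tendsto_nhds_unique hmul.hasProd.tendsto_prod_nat ?_
  simp only [prod_eq_one_add_sum_qCentralRatio hq]
  refine tendsto_const_nhds.add ?_
  obtain ⟨C, hC⟩ := exists_norm_qCentralRatio_le hq
  have hsum : Summable fun j : ℕ => ‖q‖ ^ j * 2 * (2 / (1 - ‖q‖)) * C :=
    (((summable_geometric_of_lt_one (norm_nonneg _) hq).mul_right _).mul_right _).mul_right _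
  refine (tendsto_tsum_of_dominated_convergence (𝓕 := atTop)
    (f := fun n j => (-1) ^ (j + 1) * q ^ (j + 2).choose 2 * (1 + q ^ (j + 1)) *
        (1 - q ^ (j + 1) + q ^ (2 * (j + 1)))⁻¹ * qCentralRatio q n (j + 1)) hsum
    (fun j => ?_) (Eventually.of_forall fun n j => ?_)).congr fun n => ?_
  · simpa using (tendsto_qCentralRatio hq (j + 1)).const_mul
      ((-1) ^ (j + 1) * q ^ (j + 2).choose 2 * (1 + q ^ (j + 1)) *
        (1 - q ^ (j + 1) + q ^ (2 * (j + 1)))⁻¹)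
  · rw [norm_mul]
    exact mul_le_mul (norm_crank_term_le hq j) (hC n _) (norm_nonneg _)
      ((norm_nonneg _).trans (norm_crank_term_le hq j))
  · refine tsum_eq_sum fun j hj => ?_
    have : ¬ j + 1 ≤ n := by simpa using hj
    simp [qCentralRatio, this]

end

lemma xi_even {m : ℤ} (h : Even m) : xi m = 0 := by
  obtain ⟨r, rfl⟩ := h
  unfold xi
  split_ifs <;> omega

lemma xi_neg (m : ℤ) : xi (-m) = -xi m := by
  unfold xi
  split_ifs <;> omega

lemma xi_add_six (m : ℤ) : xi (m + 6) = -xi m := by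
  unfold xi
  split_ifs <;> omega

lemma norm_xi_le (m : ℤ) : ‖(xi m : ℂ)‖ ≤ 2 := by
  unfold xi
  split_ifs <;> norm_num

lemma tsum_xi_mul_pow {y : ℂ} (hy : ‖y‖ < 1) (hD : 1 - y + y ^ 2 ≠ 0) :
    ∑' m : ℕ, (xi (2 * m + 1) : ℂ) * y ^ m = -((1 + y) * (1 - y + y ^ 2)⁻¹) := by
  have hs : Summable fun m : ℕ => (xi (2 * m + 1) : ℂ) * y ^ m := by
    refine Summable.of_norm_bounded
      ((summable_geometric_of_lt_one (norm_nonneg _) hy).mul_left 2) fun m => ?_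
    rw [norm_mul, norm_pow]
    exact mul_le_mul_of_nonneg_right (norm_xi_le _) (by positivity)
  have h := hs.sum_add_tsum_nat_add 3
  have hshift : ∀ m : ℕ, (xi (2 * (m + 3 : ℕ) + 1) : ℂ) * y ^ (m + 3) =
      -y ^ 3 * ((xi (2 * m + 1) : ℂ) * y ^ m) := by
    intro m
    rw [show (2 * ((m + 3 : ℕ) : ℤ) + 1) = (2 * m + 1) + 6 by push_cast; ring, xi_add_six]
    push_cast
    ring
  simp only [hshift, tsum_mul_left] at h
  have h1 : xi 1 = -1 := by decide
  have h3 : xi 3 = -2 := by decide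
  have h5 : xi 5 = -1 := by decide
  norm_num [sum_range_succ, h1, h3, h5] at h
  have hy1 : 1 + y ≠ 0 := by
    intro h0
    rw [show y = -1 by linear_combination h0] at hy
    simp at hy
  field_simp
  refine mul_left_cancel₀ hy1 ?_
  linear_combination -h

/-- The bijection from pairs `(k + 1, m)` to pairs `(d, e)` with `d` odd and
`(k + 1) (k + 2) / 2 + (k + 1) m = d e`. -/
def crankPair (p : ℕ × ℕ) : ℕ+ × ℕ+ :=
  if p.1 % 2 = 0 then (⟨p.1 + 1, by omega⟩, ⟨p.1 / 2 + p.2 + 1, by omega⟩)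
  else (⟨2 * (p.1 / 2 + p.2 + 1) + 1, by omega⟩, ⟨p.1 / 2 + 1, by omega⟩)

lemma crankPair_injective : Function.Injective crankPair := by
  rintro ⟨a, b⟩ ⟨c, d⟩ h
  unfold crankPair at h
  split_ifs at h <;>
  · have h1 := congrArg (fun p : ℕ+ × ℕ+ => (p.1 : ℕ)) h
    have h2 := congrArg (fun p : ℕ+ × ℕ+ => (p.2 : ℕ)) h
    simp only [PNat.mk_coe, Prod.mk.injEq] at *
    omega

lemma mem_range_crankPair {p : ℕ+ × ℕ+} (hp : (p.1 : ℕ) % 2 = 1) :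
    p ∈ Set.range crankPair := by
  obtain ⟨⟨d, hd⟩, ⟨e, he⟩⟩ := p
  simp only [PNat.mk_coe] at hp
  by_cases h : d < 2 * e
  · refine ⟨(d - 1, e - 1 - (d - 1) / 2), ?_⟩
    unfold crankPair
    rw [if_pos (by simp only; omega)]
    refine Prod.ext (PNat.eq ?_) (PNat.eq ?_) <;>
    · simp only [PNat.mk_coe]
      omega
  · refine ⟨(2 * e - 1, d / 2 - e), ?_⟩
    unfold crankPair
    rw [if_neg (by simp only; omega)]
    refine Prod.ext (PNat.eq ?_) (PNat.eq ?_) <;>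
    · simp only [PNat.mk_coe]
      omega

lemma xi_crankPair_mul_pow (q : ℂ) (k m : ℕ) :
    (xi (2 * ((crankPair (k, m)).2 : ℕ) - ((crankPair (k, m)).1 : ℕ)) : ℂ) *
        q ^ (((crankPair (k, m)).1 : ℕ) * ((crankPair (k, m)).2 : ℕ)) =
      (-1) ^ k * q ^ (k + 2).choose 2 * ((xi (2 * m + 1) : ℂ) * (q ^ (k + 1)) ^ m) := by
  obtain ⟨i, rfl | rfl⟩ := Nat.even_or_odd' k
  · have hc : (2 * i + 2).choose 2 = (2 * i + 1) * (i + 1) := by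
      rw [Nat.choose_two_right]
      refine Nat.div_eq_of_eq_mul_left two_pos ?_
      simp only [Nat.add_succ_sub_one]
      ring
    have e : crankPair (2 * i, m) = (⟨2 * i + 1, by omega⟩, ⟨i + m + 1, by omega⟩) := by
      simp [crankPair]
    rw [e, hc]
    simp only [PNat.mk_coe]
    rw [show 2 * ((i + m + 1 : ℕ) : ℤ) - ((2 * i + 1 : ℕ) : ℤ) = 2 * m + 1 by push_cast; ring,
      pow_mul (-1 : ℂ)]
    norm_num
    ring
  · have hc : (2 * i + 1 + 2).choose 2 = (2 * i + 3) * (i + 1) := by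
      rw [Nat.choose_two_right]
      refine Nat.div_eq_of_eq_mul_left two_pos ?_
      simp only [Nat.add_succ_sub_one]
      ring
    have e : crankPair (2 * i + 1, m) =
        (⟨2 * (i + m + 1) + 1, by omega⟩, ⟨i + 1, by omega⟩) := by
      have : (2 * i + 1) / 2 = i := by omega
      simp [crankPair, this, Nat.add_mod]
    rw [e, hc]
    simp only [PNat.mk_coe]
    rw [show 2 * ((i + 1 : ℕ) : ℤ) - ((2 * (i + m + 1) + 1 : ℕ) : ℤ) = -(2 * m + 1) by
      push_cast; ring, xi_neg, pow_succ, pow_mul (-1 : ℂ)]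
    norm_num
    ring

lemma a6_eq_sum_divisorsAntidiagonal (n : ℕ) :
    a6 n = ∑ x ∈ n.divisorsAntidiagonal, xi (2 * (x.2 : ℤ) - x.1) := by
  rw [Nat.sum_divisorsAntidiagonal fun x y => xi (2 * (y : ℤ) - x), a6, sum_filter]
  refine sum_congr rfl fun d _ => ?_
  split_ifs with hd
  · rw [Int.natCast_div]
  · have hd' : Even d := by simpa using hd
    exact (xi_even (by simpa [Int.even_sub] using hd')).symm

section

variable {q : ℂ}

lemma summable_xi_mul_pow (hq : ‖q‖ < 1) : Summable fun p : ℕ+ × ℕ+ =>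
    (xi (2 * (p.2 : ℕ) - (p.1 : ℕ)) : ℂ) * q ^ ((p.1 : ℕ) * (p.2 : ℕ)) := by
  have h := (summable_prod_mul_pow 0 hq).norm
  refine Summable.of_norm_bounded (h.mul_left 2) fun p => ?_
  rw [norm_mul]
  simpa using mul_le_mul_of_nonneg_right (norm_xi_le _) (norm_nonneg (q ^ ((p.1 : ℕ) * (p.2 : ℕ))))

lemma tsum_xi_mul_pow_eq_tsum_a6 (hq : ‖q‖ < 1) :
    ∑' p : ℕ+ × ℕ+, (xi (2 * (p.2 : ℕ) - (p.1 : ℕ)) : ℂ) * q ^ ((p.1 : ℕ) * (p.2 : ℕ)) =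
      ∑' n : ℕ, (a6 (n + 1) : ℂ) * q ^ (n + 1) := by
  rw [← tsum_pnat_eq_tsum_succ (f := fun n : ℕ => (a6 n : ℂ) * q ^ n)]
  have hs := sigmaAntidiagonalEquivProd.summable_iff.mpr (summable_xi_mul_pow hq)
  rw [← sigmaAntidiagonalEquivProd.tsum_eq]
  refine (Summable.tsum_sigma hs).trans ?_
  refine tsum_congr fun n => ?_
  rw [tsum_fintype, a6_eq_sum_divisorsAntidiagonal, Int.cast_sum, sum_mul,
    ← sum_coe_sort (n : ℕ).divisorsAntidiagonal]
  refine sum_congr rfl fun x _ => ?_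
  have hx := (Nat.mem_divisorsAntidiagonal.mp x.2).1
  simp only [Function.comp_apply, sigmaAntidiagonalEquivProd, divisorsAntidiagonalFactors,
    Equiv.coe_fn_mk, PNat.mk_coe, hx]

lemma tsum_crank_eq_tsum_xi_mul_pow (hq : ‖q‖ < 1) :
    ∑' j : ℕ, (-1) ^ (j + 1) * q ^ (j + 2).choose 2 * (1 + q ^ (j + 1)) *
        (1 - q ^ (j + 1) + q ^ (2 * (j + 1)))⁻¹ =
      ∑' p : ℕ+ × ℕ+, (xi (2 * (p.2 : ℕ) - (p.1 : ℕ)) : ℂ) * q ^ ((p.1 : ℕ) * (p.2 : ℕ)) := by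
  rw [← crankPair_injective.tsum_eq]
  · have hs := (summable_xi_mul_pow hq).comp_injective crankPair_injective
    refine Eq.trans ?_ (Summable.tsum_prod hs).symm
    refine tsum_congr fun k => ?_
    have hy : ‖q ^ (k + 1)‖ < 1 := by
      rw [norm_pow]
      exact pow_lt_one₀ (norm_nonneg _) hq (by simp)
    have hD := one_sub_add_sq_ne_zero hq k
    rw [mul_comm 2, pow_mul] at hD ⊢
    simp only [Function.comp_apply, xi_crankPair_mul_pow, tsum_mul_left, tsum_xi_mul_pow hy hD]
    ring
  · intro p hp
    refine mem_range_crankPair ?_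
    by_contra h
    refine hp ?_
    have : Even (2 * ((p.2 : ℕ) : ℤ) - ((p.1 : ℕ) : ℤ)) := by
      rw [Int.even_iff]
      omega
    simp [xi_even this]

end

theorem eta_quotient_eq_one_add_tsum_a6 (q : ℂ) (hq : ‖q‖ < 1) :
    (∏' n : ℕ, (1 - q ^ (n + 1)) ^ 2 / (1 - q ^ (n + 1) + q ^ (2 * (n + 1))))
      = 1 + ∑' n : ℕ, (a6 (n + 1) : ℂ) * q ^ (n + 1) := by
  rw [tprod_eq_one_add_tsum_crank hq, tsum_crank_eq_tsum_xi_mul_pow hq,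
    tsum_xi_mul_pow_eq_tsum_a6 hq]
end

section
/- For every complex number q with |q| < 1: ∏_{n≥1} (1−q^{2n})²(1−q^{3n}) / ((1−q^n)(1−q^{6n})) = ∑_{n∈ℤ} (−1)^n f(n) q^{n²}, where f(n) = 1 if n ≡ 0 (mod 3), f(n) = −1 if n ≡ 1 (mod 3), and f(n) = 0 if n ≡ 2 (mod 3). -/
/-- `f n = 1` if `n ≡ 0 (mod 3)`, `f n = −1` if `n ≡ 1 (mod 3)`, `f n = 0` if
`n ≡ 2 (mod 3)`. -/
def f (n : ℤ) : ℤ :=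
  if n % 3 = 0 then 1 else if n % 3 = 1 then -1 else 0

open Filter Topology

/-- The finite Euler product `∏_{k=1}^n (1 - x^k)`. -/
noncomputable def eulerProd (x : ℂ) (n : ℕ) : ℂ := ∏ k ∈ Finset.range n, (1 - x ^ (k + 1))

/-- The inverse of `eulerProd x m`, extended by zero to negative `m`. -/
noncomputable def invEulerProd (x : ℂ) (m : ℤ) : ℂ :=
  if 0 ≤ m then (eulerProd x m.toNat)⁻¹ else 0

lemma norm_pow_lt_one {x : ℂ} (hx : ‖x‖ < 1) {n : ℕ} (hn : n ≠ 0) : ‖x ^ n‖ < 1 := by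
  rw [norm_pow]
  exact pow_lt_one₀ (norm_nonneg _) hx hn

lemma one_sub_pow_ne_zero_s10 {x : ℂ} (hx : ‖x‖ < 1) {n : ℕ} (hn : n ≠ 0) : 1 - x ^ n ≠ 0 := by
  intro h
  have h1 := norm_pow_lt_one hx hn
  rw [← sub_eq_zero.mp h, norm_one] at h1
  exact lt_irrefl _ h1

lemma eulerProd_ne_zero {x : ℂ} (hx : ‖x‖ < 1) (n : ℕ) : eulerProd x n ≠ 0 :=
  Finset.prod_ne_zero_iff.mpr fun k _ ↦ one_sub_pow_ne_zero_s10 hx k.succ_ne_zero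

lemma invEulerProd_sub_one {x : ℂ} (hx : ‖x‖ < 1) (m : ℤ) :
    invEulerProd x (m - 1) = (1 - x ^ m) * invEulerProd x m := by
  rcases lt_trichotomy m 0 with hm | rfl | hm
  · simp [invEulerProd, show ¬ 1 ≤ m by omega, show ¬ 0 ≤ m by omega]
  · simp [invEulerProd]
  · obtain ⟨k, rfl⟩ : ∃ k : ℕ, m = k + 1 := ⟨(m - 1).toNat, by omega⟩
    have h1 := eulerProd_ne_zero hx k
    have h2 := one_sub_pow_ne_zero_s10 hx k.succ_ne_zero
    have h3 : eulerProd x (k + 1) = eulerProd x k * (1 - x ^ (k + 1)) :=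
      Finset.prod_range_succ _ _
    have h4 : x ^ ((k : ℤ) + 1) = x ^ (k + 1) := by exact_mod_cast zpow_natCast x (k + 1)
    have h5 : ((k : ℤ) + 1).toNat = k + 1 := by omega
    have h6 : (0 : ℤ) ≤ (k : ℤ) + 1 := by omega
    simp only [invEulerProd, add_sub_cancel_right, Int.toNat_natCast, h4, h5, h6, h3,
      Nat.cast_nonneg, if_true]
    field_simp

/-- The finite form of the Jacobi triple product. -/
lemma hasSum_finite_jacobi_triple {q z : ℂ} (hq0 : q ≠ 0) (hq : ‖q‖ < 1) (hz : z ≠ 0) (n : ℕ) :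
    HasSum (fun j : ℤ ↦ eulerProd (q ^ 2) (2 * n) * invEulerProd (q ^ 2) (n + j) *
        invEulerProd (q ^ 2) (n - j) * (q ^ (j ^ 2) * z ^ j))
      (∏ k ∈ Finset.range n, (1 + z * q ^ (2 * k + 1)) * (1 + z⁻¹ * q ^ (2 * k + 1))) := by
  have hx := norm_pow_lt_one hq two_ne_zero
  induction n with
  | zero =>
    convert hasSum_single (0 : ℤ) ?_ using 1
    · simp [eulerProd, invEulerProd]
    · intro j hj
      rcases lt_or_gt_of_ne hj with h | h
      · simp [invEulerProd, show ¬ 0 ≤ j by omega]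
      · simp [invEulerProd, show ¬ j ≤ 0 by omega]
  | succ n ih =>
    rw [Finset.prod_range_succ]
    set w := q ^ (2 * n + 1) with hw
    have hd := (((Equiv.subRight (1 : ℤ)).hasSum_iff.mpr ih).mul_left (z * w))
    have hu := (((Equiv.addRight (1 : ℤ)).hasSum_iff.mpr ih).mul_left (z⁻¹ * w))
    have hS (S : ℂ) : S * ((1 + z * w) * (1 + z⁻¹ * w)) =
        (1 + w ^ 2) * S + z * w * S + z⁻¹ * w * S := by
      linear_combination S * w ^ 2 * mul_inv_cancel₀ hz
    rw [hS]
    refine (((ih.mul_left (1 + w ^ 2)).add hd).add hu).congr_fun fun j ↦ ?_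
    simp only [Function.comp_apply, Equiv.subRight_apply, Equiv.coe_addRight]
    set x := q ^ 2 with hxdef
    have hx0 : x ≠ 0 := pow_ne_zero 2 hq0
    set u := x ^ ((n : ℤ) + j) with hu
    set v := x ^ ((n : ℤ) - j) with hv
    have hxu : x ^ ((n : ℤ) + 1 + j) = x * u := by
      rw [hu, ← zpow_one_add₀ hx0]; ring_nf
    have hxv : x ^ ((n : ℤ) + 1 - j) = x * v := by
      rw [hv, ← zpow_one_add₀ hx0]; ring_nf
    have huv : x ^ (2 * n) = u * v := by
      rw [hu, hv, ← zpow_add₀ hx0, ← zpow_natCast]; congr 1; push_cast; ring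
    have hw2 : w ^ 2 = x * (u * v) := by
      rw [← huv, hw, hxdef]; ring
    have hxq (m : ℤ) : x ^ m = q ^ (2 * m) := by
      rw [hxdef, zpow_mul]; norm_cast
    have hwq : w = q ^ (2 * (n : ℤ) + 1) := by
      rw [hw, ← zpow_natCast]; push_cast; rfl
    have hdown : w * q ^ ((j - 1) ^ 2) = x * v * q ^ (j ^ 2) := by
      rw [← hxv, hxq, hwq, ← zpow_add₀ hq0, ← zpow_add₀ hq0]; ring_nf
    have hup : w * q ^ ((j + 1) ^ 2) = x * u * q ^ (j ^ 2) := by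
      rw [← hxu, hxq, hwq, ← zpow_add₀ hq0, ← zpow_add₀ hq0]; ring_nf
    have hzd : z * z ^ (j - 1) = z ^ j := by rw [← zpow_one_add₀ hz]; ring_nf
    have hzu : z⁻¹ * z ^ (j + 1) = z ^ j := by
      rw [zpow_add_one₀ hz]; field_simp
    have hP : eulerProd x (2 * (n + 1)) =
        eulerProd x (2 * n) * (1 - x * (u * v)) * (1 - x ^ 2 * (u * v)) := by
      rw [← huv, eulerProd, mul_add, mul_one, Finset.prod_range_succ, Finset.prod_range_succ,
        eulerProd]
      ring
    have ha := invEulerProd_sub_one hx ((n : ℤ) + 1 + j)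
    have ha' := invEulerProd_sub_one hx ((n : ℤ) + j)
    have hb := invEulerProd_sub_one hx ((n : ℤ) + 1 - j)
    have hb' := invEulerProd_sub_one hx ((n : ℤ) - j)
    rw [hxu, show (n : ℤ) + 1 + j - 1 = n + j by ring] at ha
    rw [hxv, show (n : ℤ) + 1 - j - 1 = n - j by ring] at hb
    rw [← hu, ha] at ha'
    rw [← hv, hb] at hb'
    rw [show (n : ℤ) + (j - 1) = n + j - 1 by ring, show (n : ℤ) - (j - 1) = n + 1 - j by ring,
      show (n : ℤ) + (j + 1) = n + 1 + j by ring, show (n : ℤ) - (j + 1) = n - j - 1 by ring,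
      hP, ha', hb', ha, hb, hw2]
    push_cast
    set a := invEulerProd x ((n : ℤ) + 1 + j)
    set b := invEulerProd x ((n : ℤ) + 1 - j)
    have e1 (c : ℂ) : z * w * (c * (q ^ ((j - 1) ^ 2) * z ^ (j - 1))) =
        c * (x * v * q ^ (j ^ 2)) * z ^ j := by
      rw [← hdown, ← hzd]; ring
    have e2 (c : ℂ) : z⁻¹ * w * (c * (q ^ ((j + 1) ^ 2) * z ^ (j + 1))) =
        c * (x * u * q ^ (j ^ 2)) * z ^ j := by
      rw [← hup, ← hzu]; ring
    rw [e1, e2]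
    ring

lemma multipliable_one_add_mul_pow {q : ℂ} (hq : ‖q‖ < 1) (c : ℂ) :
    Multipliable fun k : ℕ ↦ 1 + c * q ^ (2 * k + 1) := by
  apply multipliable_one_add_of_summable
  have h := (summable_geometric_of_lt_one (norm_nonneg _) hq).comp_injective
    (i := fun k : ℕ ↦ 2 * k + 1) (fun a b h ↦ by simpa using h)
  simpa [Function.comp_def] using h.mul_left ‖c‖

lemma summable_zpow_sq_mul_zpow {q z : ℂ} (hq0 : q ≠ 0) (hq : ‖q‖ < 1) (hz : z ≠ 0) :
    Summable fun j : ℤ ↦ q ^ (j ^ 2) * z ^ j := by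
  have hpi : (Real.pi : ℂ) ≠ 0 := by exact_mod_cast Real.pi_ne_zero
  have hI := Complex.I_ne_zero
  have h := (summable_jacobiTheta₂_term_iff (Complex.log z / (2 * Real.pi * Complex.I))
    (Complex.log q / (Real.pi * Complex.I))).mpr ?_
  · refine h.congr fun j ↦ ?_
    rw [jacobiTheta₂_term, Complex.exp_add, mul_comm]
    congr 1
    · rw [show Real.pi * Complex.I * (j : ℂ) ^ 2 * (Complex.log q / (Real.pi * Complex.I)) =
        ((j ^ 2 : ℤ) : ℂ) * Complex.log q by push_cast; field_simp, Complex.exp_int_mul,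
        Complex.exp_log hq0]
    · rw [show 2 * Real.pi * Complex.I * (j : ℂ) * (Complex.log z / (2 * Real.pi * Complex.I)) =
        (j : ℂ) * Complex.log z by field_simp, Complex.exp_int_mul, Complex.exp_log hz]
  · have h1 : Complex.log q / (Real.pi * Complex.I) =
        ((Real.pi⁻¹ : ℝ) : ℂ) * (-Complex.I * Complex.log q) := by
      push_cast
      field_simp
      simp
    rw [h1, Complex.im_ofReal_mul]
    have h2 : (-Complex.I * Complex.log q).im = -Real.log ‖q‖ := by simp [Complex.log_re]
    rw [h2]
    have := Real.log_neg (norm_pos_iff.mpr hq0) hq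
    have := Real.pi_pos
    exact mul_pos (by positivity) (by linarith)

lemma tprod_one_sub_pow_ne_zero {x : ℂ} (hx : ‖x‖ < 1) : ∏' n : ℕ, (1 - x ^ (n + 1)) ≠ 0 := by
  simp_rw [sub_eq_add_neg]
  refine tprod_one_add_ne_zero_of_summable (fun n ↦ ?_) ?_
  · rw [← sub_eq_add_neg]
    exact one_sub_pow_ne_zero_s10 hx n.succ_ne_zero
  · simpa using (summable_nat_add_iff 1).mpr (summable_geometric_of_lt_one (norm_nonneg _) hx)

lemma tendsto_eulerProd {x : ℂ} (hx : ‖x‖ < 1) :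
    Tendsto (eulerProd x) atTop (𝓝 (∏' n : ℕ, (1 - x ^ (n + 1)))) :=
  (ModularForm.multipliable_one_sub_pow hx).hasProd.tendsto_prod_nat

/-- The **Jacobi triple product** identity. -/
theorem jacobi_triple_product {q z : ℂ} (hq0 : q ≠ 0) (hq : ‖q‖ < 1) (hz : z ≠ 0) :
    (∏' n : ℕ, (1 - (q ^ 2) ^ (n + 1))) *
      ((∏' k : ℕ, (1 + z * q ^ (2 * k + 1))) * ∏' k : ℕ, (1 + z⁻¹ * q ^ (2 * k + 1))) =
      ∑' j : ℤ, q ^ (j ^ 2) * z ^ j := by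
  have hx := norm_pow_lt_one hq two_ne_zero
  have hfin := fun n ↦ (hasSum_finite_jacobi_triple hq0 hq hz n).tsum_eq
  set x := q ^ 2
  set E := ∏' n : ℕ, (1 - x ^ (n + 1))
  have hE0 : E ≠ 0 := tprod_one_sub_pow_ne_zero hx
  have hlim := tendsto_eulerProd hx
  have hlimInv : Tendsto (fun n ↦ (eulerProd x n)⁻¹) atTop (𝓝 E⁻¹) := hlim.inv₀ hE0
  have hR : Tendsto (invEulerProd x) atTop (𝓝 E⁻¹) := by
    have ht : Tendsto Int.toNat atTop atTop :=
      tendsto_atTop.mpr fun b ↦ (eventually_ge_atTop (b : ℤ)).mono fun m hm ↦ by omega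
    refine (hlimInv.comp ht).congr' ?_
    filter_upwards [eventually_ge_atTop 0] with m hm
    simp [invEulerProd, hm]
  obtain ⟨C, hC⟩ := hlim.norm.bddAbove_range
  obtain ⟨D, hD⟩ := hlimInv.norm.bddAbove_range
  have hC' (n : ℕ) : ‖eulerProd x n‖ ≤ C := hC ⟨n, rfl⟩
  have hD' (n : ℕ) : ‖(eulerProd x n)⁻¹‖ ≤ D := hD ⟨n, rfl⟩
  have hC0 : 0 ≤ C := (norm_nonneg _).trans (hC' 0)
  have hD0 : 0 ≤ D := (norm_nonneg _).trans (hD' 0)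
  have hR' (m : ℤ) : ‖invEulerProd x m‖ ≤ D := by
    rw [invEulerProd]
    split_ifs
    · exact hD' _
    · simpa using hD0
  have hsum := tendsto_tsum_of_dominated_convergence
    (f := fun (n : ℕ) (j : ℤ) ↦ eulerProd x (2 * n) * invEulerProd x (n + j) *
        invEulerProd x (n - j) * (q ^ (j ^ 2) * z ^ j))
    (g := fun j : ℤ ↦ E * E⁻¹ * E⁻¹ * (q ^ (j ^ 2) * z ^ j)) (𝓕 := atTop)
    (bound := fun j ↦ C * D * D * ‖q ^ (j ^ 2) * z ^ j‖)
    ((summable_zpow_sq_mul_zpow hq0 hq hz).norm.mul_left _) (fun j ↦ ?_) (.of_forall fun n j ↦ ?_)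
  · simp_rw [hfin, Finset.prod_mul_distrib] at hsum
    have hprod := ((multipliable_one_add_mul_pow hq z).hasProd.tendsto_prod_nat).mul
      ((multipliable_one_add_mul_pow hq z⁻¹).hasProd.tendsto_prod_nat)
    rw [tendsto_nhds_unique hprod hsum, tsum_mul_left]
    field_simp
  · have hadd : Tendsto (fun n : ℕ ↦ (n : ℤ) + j) atTop atTop :=
      tendsto_atTop_add_const_right _ _ tendsto_natCast_atTop_atTop
    have hsub : Tendsto (fun n : ℕ ↦ (n : ℤ) - j) atTop atTop :=
      tendsto_atTop_add_const_right _ _ tendsto_natCast_atTop_atTop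
    have hdouble : Tendsto (fun n : ℕ ↦ 2 * n) atTop atTop :=
      tendsto_id.const_mul_atTop' two_pos
    exact (((hlim.comp hdouble).mul (hR.comp hadd)).mul (hR.comp hsub)).mul_const _
  · rw [norm_mul, norm_mul, norm_mul]
    gcongr
    · exact hC' _
    · exact hR' _
    · exact hR' _

/-- The product over odd exponents as a quotient of two Euler products. -/
lemma tprod_one_sub_odd_pow {x : ℂ} (hx : ‖x‖ < 1) :
    (∏' k : ℕ, (1 - x ^ (2 * k + 1))) * ∏' k : ℕ, (1 - (x ^ 2) ^ (k + 1)) =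
      ∏' k : ℕ, (1 - x ^ (k + 1)) := by
  have hx2 := norm_pow_lt_one hx two_ne_zero
  have ho : Multipliable fun k : ℕ ↦ 1 - x ^ (2 * k + 1) := by
    simpa [sub_eq_add_neg] using multipliable_one_add_mul_pow hx (-1)
  have he : Multipliable fun k : ℕ ↦ 1 - x ^ (2 * k + 1 + 1) := by
    convert ModularForm.multipliable_one_sub_pow hx2 using 3
    ring
  rw [← tprod_even_mul_odd (f := fun k ↦ 1 - x ^ (k + 1)) ho he]
  congr 2
  ext k
  ring

lemma ne_zero_of_sq_add_self_add_one {ω : ℂ} (hω : ω ^ 2 + ω + 1 = 0) : ω ≠ 0 := by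
  rintro rfl
  simp at hω

lemma inv_eq_of_sq_add_self_add_one {ω : ℂ} (hω : ω ^ 2 + ω + 1 = 0) : ω⁻¹ = -1 - ω := by
  rw [inv_eq_iff_eq_inv, eq_comm, inv_eq_of_mul_eq_one_left]
  linear_combination -hω

/-- `f` and `n ↦ ω ^ n`, for `ω` a primitive cube root of unity, have the same even part. -/
lemma f_add_f_neg {ω : ℂ} (hω : ω ^ 2 + ω + 1 = 0) (n : ℤ) :
    (f n : ℂ) + f (-n) = ω ^ n + ω ^ (-n) := by
  have h0 := ne_zero_of_sq_add_self_add_one hω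
  have h3 : ω ^ (3 : ℤ) = 1 := by
    have : ω ^ 3 = 1 := by linear_combination (ω - 1) * hω
    exact_mod_cast this
  have hinv := inv_eq_of_sq_add_self_add_one hω
  obtain ⟨k, hk⟩ : ∃ k, n = 3 * k + n % 3 := ⟨n / 3, by omega⟩
  have hpow : ω ^ n = ω ^ (n % 3) := by
    conv_lhs => rw [hk]
    rw [zpow_add₀ h0, zpow_mul, h3, one_zpow, one_mul]
  rw [zpow_neg, hpow]
  rcases (by omega : n % 3 = 0 ∨ n % 3 = 1 ∨ n % 3 = 2) with h | h | h
  · simp [f, h, show (-n) % 3 = 0 by omega]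
  · simp [f, h, show (-n) % 3 = 2 by omega, hinv]
  · rw [h, show (2 : ℤ) = ((2 : ℕ) : ℤ) from rfl, zpow_natCast, ← inv_pow, hinv]
    simp [f, h, show (-n) % 3 = 1 by omega]
    linear_combination -2 * hω

lemma tsum_f_mul_zpow {q ω : ℂ} (hq0 : q ≠ 0) (hq : ‖q‖ < 1) (hω : ω ^ 2 + ω + 1 = 0) :
    ∑' n : ℤ, (-1 : ℂ) ^ n * (f n : ℂ) * q ^ (n ^ 2) = ∑' n : ℤ, q ^ (n ^ 2) * (-ω) ^ n := by
  have h0 := ne_zero_of_sq_add_self_add_one hω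
  have hs1 : Summable fun n : ℤ ↦ (-1 : ℂ) ^ n * (f n : ℂ) * q ^ (n ^ 2) := by
    refine (summable_zpow_sq_mul_zpow hq0 hq one_ne_zero).norm.of_norm_bounded fun n ↦ ?_
    have hf : ‖(f n : ℂ)‖ ≤ 1 := by
      rw [f]
      split_ifs <;> simp
    simpa [norm_zpow] using mul_le_mul_of_nonneg_right hf (norm_nonneg (q ^ (n ^ 2)))
  have hs2 := summable_zpow_sq_mul_zpow hq0 hq (neg_ne_zero.mpr h0)
  have key := congrArg tsum (funext fun n : ℤ ↦ show
      (-1 : ℂ) ^ n * (f n : ℂ) * q ^ (n ^ 2) + (-1 : ℂ) ^ (-n) * (f (-n) : ℂ) * q ^ ((-n) ^ 2) =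
      q ^ (n ^ 2) * (-ω) ^ n + q ^ ((-n) ^ 2) * (-ω) ^ (-n) by
    have hneg : (-1 : ℂ) ^ (-n) = (-1) ^ n := by rw [zpow_neg, ← inv_zpow]; norm_num
    rw [neg_sq, neg_eq_neg_one_mul ω, mul_zpow, mul_zpow, hneg]
    linear_combination (-1 : ℂ) ^ n * q ^ (n ^ 2) * f_add_f_neg hω n)
  have hn1 := (Equiv.neg ℤ).tsum_eq fun n : ℤ ↦ (-1 : ℂ) ^ n * (f n : ℂ) * q ^ (n ^ 2)
  have hn2 := (Equiv.neg ℤ).tsum_eq fun n : ℤ ↦ q ^ (n ^ 2) * (-ω) ^ n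
  have hm1 := (Equiv.neg ℤ).summable_iff.mpr hs1
  have hm2 := (Equiv.neg ℤ).summable_iff.mpr hs2
  simp only [Equiv.neg_apply, Function.comp_def] at hn1 hn2 hm1 hm2
  rw [hs1.tsum_add hm1, hs2.tsum_add hm2, hn1, hn2] at key
  linear_combination key / 2

theorem kac_identity (q : ℂ) (hq : ‖q‖ < 1) :
    (∏' n : ℕ, ((1 - q ^ (2 * (n + 1))) ^ 2 * (1 - q ^ (3 * (n + 1))))
        / ((1 - q ^ (n + 1)) * (1 - q ^ (6 * (n + 1)))))
      = ∑' n : ℤ, (-1 : ℂ) ^ n * (f n : ℂ) * q ^ (n ^ 2) := by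
  rcases eq_or_ne q 0 with rfl | hq0
  · rw [tsum_eq_single (0 : ℤ) fun n hn ↦ by simp [zero_zpow _ (pow_ne_zero 2 hn)]]
    simp [f]
  obtain ⟨ω, hω⟩ : ∃ ω : ℂ, ω ^ 2 + ω + 1 = 0 := by
    obtain ⟨s, hs⟩ := IsAlgClosed.exists_pow_nat_eq (-3 : ℂ) two_pos
    exact ⟨(-1 + s) / 2, by linear_combination hs / 4⟩
  have h0 := ne_zero_of_sq_add_self_add_one hω
  have hinv := inv_eq_of_sq_add_self_add_one hω
  have hm1 := ModularForm.multipliable_one_sub_pow hq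
  have hm2 := ModularForm.multipliable_one_sub_pow (norm_pow_lt_one hq two_ne_zero)
  have hm3 := ModularForm.multipliable_one_sub_pow (norm_pow_lt_one hq three_ne_zero)
  have hm6 := ModularForm.multipliable_one_sub_pow (norm_pow_lt_one hq (n := 6) (by norm_num))
  have hE1 := tprod_one_sub_pow_ne_zero hq
  have hE6 := tprod_one_sub_pow_ne_zero (norm_pow_lt_one hq (n := 6) (by norm_num))
  have hodd1 := tprod_one_sub_odd_pow hq
  have hodd3 := tprod_one_sub_odd_pow (norm_pow_lt_one hq three_ne_zero)
  rw [show (q ^ 3) ^ 2 = q ^ 6 by ring] at hodd3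
  have hcube : ((∏' k : ℕ, (1 + -ω * q ^ (2 * k + 1))) * ∏' k : ℕ, (1 + (-ω)⁻¹ * q ^ (2 * k + 1))) *
      ∏' k : ℕ, (1 - q ^ (2 * k + 1)) = ∏' k : ℕ, (1 - (q ^ 3) ^ (2 * k + 1)) := by
    have ho : Multipliable fun k : ℕ ↦ 1 - q ^ (2 * k + 1) := by
      simpa [sub_eq_add_neg] using multipliable_one_add_mul_pow hq (-1)
    have hp := multipliable_one_add_mul_pow hq (-ω)
    have hp' := multipliable_one_add_mul_pow hq (-ω)⁻¹
    rw [← hp.tprod_mul hp', ← (hp.mul hp').tprod_mul ho]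
    refine tprod_congr fun k ↦ ?_
    rw [pow_right_comm, inv_neg, hinv]
    generalize q ^ (2 * k + 1) = y
    linear_combination (-y ^ 2 * (1 - y)) * hω
  rw [tsum_f_mul_zpow hq0 hq hω, ← jacobi_triple_product hq0 hq (neg_ne_zero.mpr h0)]
  simp_rw [pow_mul q]
  rw [Multipliable.tprod_div₀ ((hm2.pow 2).mul hm3) (hm1.mul hm6) (by
      rw [hm1.tprod_mul hm6]; exact mul_ne_zero hE1 hE6),
    (hm2.pow 2).tprod_mul hm3, hm1.tprod_mul hm6, hm2.tprod_pow, div_eq_iff (mul_ne_zero hE1 hE6)]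
  generalize (∏' k : ℕ, (1 + -ω * q ^ (2 * k + 1))) * ∏' k : ℕ, (1 + (-ω)⁻¹ * q ^ (2 * k + 1)) = T
    at hcube ⊢
  set E₂ := ∏' n : ℕ, (1 - (q ^ 2) ^ (n + 1))
  set E₆ := ∏' n : ℕ, (1 - (q ^ 6) ^ (n + 1))
  linear_combination -E₂ ^ 2 * hodd3 - E₂ ^ 2 * E₆ * hcube + E₂ * T * E₆ * hodd1
end
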